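/- Let α, γ, r ∈ ℝ satisfy r > 0, 0 ≤ α − γ ≤ 1 and 0 < 1/r + γ/2 = (α+1)/2, and set p = α and q = γr. Suppose C > 0 is a constant such that (∫_{ℝ²} |u(x)|^r |x|^{γr} dx)^{1/r} ≤ C ∫_{ℝ²} |∇u(x)| |x|^α dx holds for all u ∈ C_c^∞(ℝ²). Then for every bounded open set Ω ⊂ ℝ² with smooth (C^∞) boundary, (∫_Ω |x|^q dx)^((p+1)/(q+2)) ≤ C ∫_{∂Ω} |x|^p dσ(x); moreover these p, q satisfy −2 < p − 1 ≤ q ≤ 2p. -/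

import Mathlib

open MeasureTheory Metric Real

/-- `Ω ⊂ ℝ²` has smooth (`C^∞`) boundary: its topological boundary is a finite
union of images of periodic regular smooth closed curves. -/
def HasSmoothBoundary (Ω : Set (EuclideanSpace ℝ (Fin 2))) : Prop :=
  ∃ (n : ℕ) (γ : Fin n → ℝ → EuclideanSpace ℝ (Fin 2)),
    (∀ i, ContDiff ℝ (⊤ : ℕ∞) (γ i)) ∧ (∀ i, Function.Periodic (γ i) 1) ∧
    (∀ i t, deriv (γ i) t ≠ 0) ∧ frontier Ω = ⋃ i, Set.range (γ i)

abbrev E2 := EuclideanSpace ℝ (Fin 2)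

/-- points whose forward segment of length `h` in direction `e` meets `A`. -/
def slab (A : Set E2) (e : E2) (h : ℝ) : Set E2 := {x | ∃ t ∈ Set.Icc 0 h, x + t • e ∈ A}

lemma volume_slab_piece (A : Set E2) (e : E2) (he : ‖e‖ = 1) (h : ℝ) :
    volume (slab A e h) ≤ (ediam A + ENNReal.ofReal h) * ediam A := by
  obtain ⟨b, hb⟩ := Orthonormal.exists_orthonormalBasis_extension_of_card_eq (𝕜 := ℝ) (E := E2)
    (ι := Fin 2) (by simp) (v := fun _ => e) (s := {0}) (by
      rw [orthonormal_iff_ite]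
      rintro ⟨i, hi⟩ ⟨j, hj⟩
      simp only [Set.mem_singleton_iff] at hi hj
      subst hi; subst hj
      simp [he])
  have hb0 : b 0 = e := hb 0 (by simp)
  have mp : MeasurePreserving (fun x : E2 => WithLp.ofLp (b.repr x)) volume volume :=
    (PiLp.volume_preserving_ofLp (Fin 2)).comp b.measurePreserving_repr
  set P : E2 → (Fin 2 → ℝ) := fun x : E2 => WithLp.ofLp (b.repr x) with hP
  have hinj : Function.Injective P := by
    intro x y hxy
    exact b.repr.injective (WithLp.ofLp_injective 2 hxy)
  have hemb : MeasurableEmbedding P := by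
    have : Topology.IsClosedEmbedding P := by
      have h1 := (PiLp.homeomorph 2 (fun _ : Fin 2 => ℝ))
      have : P = (PiLp.homeomorph 2 (fun _ : Fin 2 => ℝ)) ∘ b.repr.toHomeomorph := by
        ext; rfl
      rw [this]
      exact (b.repr.toHomeomorph.trans (PiLp.homeomorph 2 (fun _ : Fin 2 => ℝ))).isClosedEmbedding
    exact this.measurableEmbedding
  have hv : volume (slab A e h) = volume (P '' slab A e h) := by
    rw [← mp.measure_preimage_emb hemb, Set.preimage_image_eq _ hinj]
  have hnorm : ∀ x y : E2, ∀ i, |P x i - P y i| ≤ dist x y := by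
    intro x y i
    have := PiLp.norm_apply_le (p := 2) (b.repr (x - y)) i
    rw [b.repr.norm_map] at this
    rw [dist_eq_norm]
    simpa [hP] using this
  have hdist : ∀ x ∈ A, ∀ y ∈ A, ENNReal.ofReal (dist x y) ≤ ediam A := by
    intro x hx y hy
    rw [← edist_dist]; exact edist_le_ediam_of_mem hx hy
  have hPe0 : ∀ x (t : ℝ), P (x + t • e) 0 = P x 0 + t := by
    intro x t
    simp [hP, ← hb0]
  have hPe1 : ∀ x (t : ℝ), P (x + t • e) 1 = P x 1 := by
    intro x t
    simp [hP, ← hb0]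
  rw [hv]
  refine (Real.volume_pi_le_prod_diam _).trans ?_
  rw [Fin.prod_univ_two]
  gcongr
  · apply ediam_le
    rintro _ ⟨_, ⟨x, ⟨t, ht, hx⟩, rfl⟩, rfl⟩ _ ⟨_, ⟨y, ⟨s, hs, hy⟩, rfl⟩, rfl⟩
    rw [edist_dist, Real.dist_eq]
    refine le_trans ?_ (add_le_add_left (hdist _ hx _ hy) _)
    rw [← ENNReal.ofReal_add dist_nonneg (ht.1.trans ht.2)]
    apply ENNReal.ofReal_le_ofReal
    have := hnorm (x + t • e) (y + s • e) 0
    rw [hPe0, hPe0] at this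
    simp only [Function.eval]
    rw [abs_le] at this ⊢
    constructor <;> linarith [ht.1, ht.2, hs.1, hs.2]
  · apply ediam_le
    rintro _ ⟨_, ⟨x, ⟨t, ht, hx⟩, rfl⟩, rfl⟩ _ ⟨_, ⟨y, ⟨s, hs, hy⟩, rfl⟩, rfl⟩
    rw [edist_dist, Real.dist_eq]
    refine le_trans ?_ (hdist _ hx _ hy)
    apply ENNReal.ofReal_le_ofReal
    have := hnorm (x + t • e) (y + s • e) 1
    rw [hPe1, hPe1] at this
    exact this

lemma volume_slab_le (A : Set E2) (e : E2) (he : ‖e‖ = 1) (h : ℝ) (hh : 0 < h) :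
    volume (slab A e h) ≤ ENNReal.ofReal h * μH[1] A := by
  have key : ∀ δ : ℝ, 0 < δ → volume (slab A e h) ≤ ENNReal.ofReal (δ + h) * μH[1] A := by
    intro δ hδ
    rw [mul_comm, ← ENNReal.div_le_iff_le_mul (Or.inl (ENNReal.ofReal_pos.2 (by linarith)).ne') (Or.inl ENNReal.ofReal_ne_top),
      Measure.hausdorffMeasure_apply]
    apply le_iSup_of_le (ENNReal.ofReal δ)
    apply le_iSup_of_le (ENNReal.ofReal_pos.2 hδ)
    refine le_iInf fun t => le_iInf fun hcov => le_iInf fun hd => ?_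
    rw [ENNReal.div_le_iff_le_mul (Or.inl (ENNReal.ofReal_pos.2 (by linarith)).ne') (Or.inl ENNReal.ofReal_ne_top), mul_comm, ← ENNReal.tsum_mul_left]
    have hsub : slab A e h ⊆ ⋃ n, slab (t n) e h := by
      rintro x ⟨s, hs, hx⟩
      obtain ⟨n, hn⟩ := Set.mem_iUnion.1 (hcov hx)
      exact Set.mem_iUnion.2 ⟨n, s, hs, hn⟩
    refine (measure_mono hsub).trans ((measure_iUnion_le _).trans ?_)
    refine ENNReal.tsum_le_tsum fun n => ?_
    rcases (t n).eq_empty_or_nonempty with h0 | h0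
    · have : slab (t n) e h = ∅ := by
        ext x; simp [slab, h0]
      simp [this]
    · refine (volume_slab_piece _ e he h).trans ?_
      rw [iSup_pos h0, ENNReal.rpow_one, ENNReal.ofReal_add hδ.le hh.le]
      gcongr
      exact hd n
  have hlim : Filter.Tendsto (fun δ : ℝ => ENNReal.ofReal (δ + h) * μH[1] A)
      (nhdsWithin 0 (Set.Ioi 0)) (nhds (ENNReal.ofReal h * μH[1] A)) := by
    apply ENNReal.Tendsto.mul_const
    · apply ENNReal.tendsto_ofReal
      have : Continuous fun δ : ℝ => δ + h := by fun_prop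
      have := (this.tendsto 0).mono_left (nhdsWithin_le_nhds (s := Set.Ioi 0))
      simpa using this
    · left; simpa using hh
  refine ge_of_tendsto hlim ?_
  filter_upwards [self_mem_nhdsWithin] with δ hδ using key δ hδ

lemma lintegral_slab_le (S : Set E2) (e : E2) (he : ‖e‖ = 1) (h : ℝ)
    (hh : 0 < h) (f : E2 → ℝ) (hf0 : ∀ x, 0 ≤ f x) (K : NNReal) (hf : LipschitzWith K f) :
    ∫⁻ x in slab S e h, ENNReal.ofReal (f x) ≤
      ENNReal.ofReal h * ∫⁻ x in S, ENNReal.ofReal (f x + K * h) ∂μH[1] := by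
  have hfc := hf.continuous
  rw [lintegral_eq_lintegral_meas_lt _ (Filter.Eventually.of_forall hf0)
      hfc.measurable.aemeasurable,
    lintegral_eq_lintegral_meas_lt _ (Filter.Eventually.of_forall
      (fun x => by have := hf0 x; positivity)) (by fun_prop), ← lintegral_const_mul' _ _ (by simp)]
  refine lintegral_mono fun t => ?_
  have m1 : MeasurableSet {a | t < f a} := (isOpen_lt continuous_const hfc).measurableSet
  have m2 : MeasurableSet {a | t < f a + K * h} :=
    (isOpen_lt continuous_const (by fun_prop)).measurableSet
  rw [Measure.restrict_apply m1, Measure.restrict_apply m2]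
  refine le_trans (measure_mono ?_) (volume_slab_le _ e he h hh)
  rintro x ⟨hx, s, hs, hxs⟩
  refine ⟨s, hs, ?_, hxs⟩
  have := hf.dist_le_mul x (x + s • e)
  rw [Real.dist_eq, dist_eq_norm] at this
  have h2 : ‖x - (x + s • e)‖ = s := by
    simp [norm_smul, he, abs_of_nonneg hs.1]
  rw [h2] at this
  have h3 : (K:ℝ) * s ≤ K * h := by gcongr; exact hs.2
  simp only [Set.mem_ofPred_eq] at hx ⊢
  linarith [(abs_le.1 this).2]

lemma slab_of_mem_xor (Ω : Set E2) (hΩ : IsOpen Ω) (e : E2) (h : ℝ) (hh : 0 < h) (y : E2)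
    (hy : y ∉ slab (frontier Ω) e h) : (y + h • e ∈ Ω ↔ y ∈ Ω) := by
  have hseg : IsPreconnected ((fun t : ℝ => y + t • e) '' Set.Icc 0 h) :=
    isPreconnected_Icc.image _ (by fun_prop)
  have h0 : y ∈ (fun t : ℝ => y + t • e) '' Set.Icc 0 h := ⟨0, ⟨le_rfl, hh.le⟩, by simp⟩
  have h1 : y + h • e ∈ (fun t : ℝ => y + t • e) '' Set.Icc 0 h := ⟨h, ⟨hh.le, le_rfl⟩, rfl⟩
  have hd : ∀ z ∈ (fun t : ℝ => y + t • e) '' Set.Icc 0 h, z ∉ frontier Ω := by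
    rintro _ ⟨t, ht, rfl⟩ hz
    exact hy ⟨t, ht, hz⟩
  have := isPreconnected_iff_subset_of_disjoint.1 hseg Ω (closure Ω)ᶜ hΩ
    isClosed_closure.isOpen_compl (by
      intro z hz
      by_cases hc : z ∈ closure Ω
      · left
        by_contra hn
        exact hd z hz ⟨hc, by rwa [hΩ.interior_eq]⟩
      · right; exact hc) (by
      ext z
      simp only [Set.mem_inter_iff, Set.mem_compl_iff, Set.mem_empty_iff_false, iff_false]
      rintro ⟨_, h3, h4⟩
      exact h4 (subset_closure h3))
  rcases this with h2 | h2
  · exact ⟨fun _ => h2 h0, fun _ => h2 h1⟩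
  · exact ⟨fun h3 => absurd (subset_closure h3) (h2 h1), fun h3 => absurd (subset_closure h3) (h2 h0)⟩

noncomputable def moll (Ω : Set E2) (φ : E2 → ℝ) : E2 → ℝ :=
  convolution (Ω.indicator (fun _ => (1:ℝ))) φ (ContinuousLinearMap.lsmul ℝ ℝ) volume

lemma moll_apply (Ω : Set E2) (φ : E2 → ℝ) (x : E2) :
    moll Ω φ x = ∫ y, Ω.indicator (fun _ => (1:ℝ)) y * φ (x - y) := by
  simp [moll, convolution_def]

lemma locInt_ind (Ω : Set E2) (hΩ : IsOpen Ω) :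
    LocallyIntegrable (Ω.indicator (fun _ => (1:ℝ))) (volume : Measure E2) :=
  (locallyIntegrable_const (1:ℝ)).indicator hΩ.measurableSet

lemma moll_contDiff (Ω : Set E2) (hΩ : IsOpen Ω) (φ : E2 → ℝ)
    (hφ : ContDiff ℝ (⊤ : ℕ∞) φ) (hc : HasCompactSupport φ) :
    ContDiff ℝ (⊤ : ℕ∞) (moll Ω φ) :=
  hc.contDiff_convolution_right _ (locInt_ind Ω hΩ) hφ

lemma moll_int (Ω : Set E2) (hΩ : IsOpen Ω) (φ : E2 → ℝ)
    (hφ : Continuous φ) (hc : HasCompactSupport φ) (x : E2) :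
    Integrable (fun y => Ω.indicator (fun _ => (1:ℝ)) y * φ (x - y)) := by
  have := (locInt_ind Ω hΩ).integrable_smul_right_of_hasCompactSupport
    (g := fun y => φ (x - y)) (by fun_prop) (hc.comp_homeomorph (Homeomorph.subLeft x))
  simpa using this

lemma moll_diff_le (Ω : Set E2) (hΩ : IsOpen Ω) (φ : E2 → ℝ) (hφ0 : ∀ x, 0 ≤ φ x)
    (hφ : Continuous φ) (hc : HasCompactSupport φ) (K : NNReal) (hK : LipschitzWith K φ)
    (hS : μH[1] (frontier Ω) < ⊤)
    (x e : E2) (he : ‖e‖ = 1) (h : ℝ) (hh : 0 < h) :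
    |moll Ω φ (x + h • e) - moll Ω φ x| ≤
      h * ∫ y in frontier Ω, (φ (x - y) + K * h) ∂μH[1] := by
  have hfin : IsFiniteMeasure ((μH[1] : Measure E2).restrict (frontier Ω)) :=
    ⟨by simpa using hS⟩
  have e1 : moll Ω φ (x + h • e) =
      ∫ y, Ω.indicator (fun _ => (1:ℝ)) (y + h • e) * φ (x - y) := by
    rw [moll_apply, ← integral_add_right_eq_self _ (h • e)]
    congr 1; ext y
    congr 2; abel
  have hi1 : Integrable (fun y => Ω.indicator (fun _ => (1:ℝ)) (y + h • e) * φ (x - y)) := by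
    have := (moll_int Ω hΩ φ hφ hc (x + h • e)).comp_add_right (h • e)
    refine this.congr (Filter.Eventually.of_forall fun y => ?_)
    simp only
    congr 2; abel
  have hKx : LipschitzWith K (fun y => φ (x - y)) := by
    apply LipschitzWith.of_dist_le_mul
    intro a b
    have := hK.dist_le_mul (x - a) (x - b)
    rwa [dist_sub_left] at this
  have hint : Integrable (fun y => φ (x - y) + K * h) ((μH[1] : Measure E2).restrict (frontier Ω)) := by
    refine Integrable.add ?_ (integrable_const _)
    obtain ⟨B, hB⟩ := hc.exists_bound_of_continuous hφ
    exact Integrable.of_bound (by fun_prop : Continuous fun y => φ (x - y)).aestronglyMeasurable B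
      (Filter.Eventually.of_forall fun y => hB _)
  have main : ENNReal.ofReal |moll Ω φ (x + h • e) - moll Ω φ x| ≤
      ENNReal.ofReal (h * ∫ y in frontier Ω, (φ (x - y) + K * h) ∂μH[1]) := by
    rw [ENNReal.ofReal_mul hh.le, ofReal_integral_eq_lintegral_ofReal hint
      (Filter.Eventually.of_forall fun y => by have := hφ0 (x - y); simp only [Pi.zero_apply]; positivity)]
    refine le_trans ?_ (lintegral_slab_le (frontier Ω) e he h hh (fun y => φ (x - y))
      (fun y => hφ0 _) K hKx)
    refine le_trans ?_ (lintegral_indicator_le _ _)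
    rw [e1, moll_apply, ← integral_sub hi1 (moll_int Ω hΩ φ hφ hc x), ← Real.norm_eq_abs,
      ofReal_norm]
    refine (enorm_integral_le_lintegral_enorm _).trans (lintegral_mono fun y => ?_)
    by_cases hy : y ∈ slab (frontier Ω) e h
    · rw [Set.indicator_of_mem hy, ← ofReal_norm]
      apply ENNReal.ofReal_le_ofReal
      have := hφ0 (x - y)
      rw [← sub_mul, norm_mul, Real.norm_of_nonneg this]
      apply mul_le_of_le_one_left this
      by_cases a : y + h • e ∈ Ω <;> by_cases b : y ∈ Ω <;> simp [a, b]
    · have := slab_of_mem_xor Ω hΩ e h hh y hy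
      by_cases b : y ∈ Ω <;> simp [this, b]
  rw [ENNReal.ofReal_le_ofReal_iff] at main
  · exact main
  · refine mul_nonneg hh.le (integral_nonneg fun y => ?_)
    have := hφ0 (x - y); simp only [Pi.zero_apply]; positivity

lemma moll_grad_le (Ω : Set E2) (hΩ : IsOpen Ω) (φ : E2 → ℝ) (hφ0 : ∀ x, 0 ≤ φ x)
    (hφ : ContDiff ℝ (⊤ : ℕ∞) φ) (hc : HasCompactSupport φ)
    (hS : μH[1] (frontier Ω) < ⊤) (x : E2) :
    ‖fderiv ℝ (moll Ω φ) x‖ ≤ ∫ y in frontier Ω, φ (x - y) ∂μH[1] := by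
  have hfin : IsFiniteMeasure ((μH[1] : Measure E2).restrict (frontier Ω)) :=
    ⟨by simpa using hS⟩
  obtain ⟨K, hK⟩ := hφ.lipschitzWith_of_hasCompactSupport hc (by simp)
  have hφc := hφ.continuous
  have hint : Integrable (fun y => φ (x - y)) ((μH[1] : Measure E2).restrict (frontier Ω)) := by
    obtain ⟨B, hB⟩ := hc.exists_bound_of_continuous hφc
    exact Integrable.of_bound (by fun_prop : Continuous fun y => φ (x - y)).aestronglyMeasurable B
      (Filter.Eventually.of_forall fun y => hB _)
  refine ContinuousLinearMap.opNorm_le_of_unit_norm (integral_nonneg fun y => hφ0 _) ?_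
  intro e he
  set M := ((μH[1] : Measure E2).restrict (frontier Ω)).real Set.univ with hM
  have hdiff : HasDerivAt (fun t : ℝ => moll Ω φ (x + t • e)) (fderiv ℝ (moll Ω φ) x e) 0 := by
    have h1 : DifferentiableAt ℝ (moll Ω φ) x :=
      (moll_contDiff Ω hΩ φ hφ hc).differentiable (by simp) x
    exact (h1.hasFDerivAt.hasLineDerivAt e)
  have ht := (hdiff.tendsto_slope_zero_right).norm
  have hlim : Filter.Tendsto (fun t : ℝ => (∫ y in frontier Ω, φ (x - y) ∂μH[1]) + K * t * M)
      (nhdsWithin 0 (Set.Ioi 0)) (nhds (∫ y in frontier Ω, φ (x - y) ∂μH[1])) := by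
    have : Continuous fun t : ℝ => (∫ y in frontier Ω, φ (x - y) ∂μH[1]) + K * t * M := by fun_prop
    have := (this.tendsto 0).mono_left (nhdsWithin_le_nhds (s := Set.Ioi 0))
    simpa using this
  refine le_of_tendsto_of_tendsto ht hlim ?_
  filter_upwards [self_mem_nhdsWithin] with t ht0
  have ht0 : 0 < t := ht0
  have := moll_diff_le Ω hΩ φ hφ0 hφc hc K hK hS x e he t ht0
  rw [integral_add hint (integrable_const _), integral_const, smul_eq_mul] at this
  rw [norm_smul, Real.norm_eq_abs, Real.norm_eq_abs, abs_inv, abs_of_pos ht0, inv_mul_le_iff₀ ht0]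
  simp only [zero_add, zero_smul, add_zero]
  refine this.trans (le_of_eq ?_)
  rw [hM]; ring

/-- Local integrability of powers of the norm in the plane. -/
lemma locInt_rpow (α : ℝ) (hα : -2 < α) :
    LocallyIntegrable (fun x : E2 => ‖x‖ ^ α) volume := by
  refine locallyIntegrable_of_norm_le_rpow (C := 1) (α := -α) (by simp) (by simp; linarith) ?_ ?_
  · refine Filter.Eventually.of_forall fun x => ?_
    rw [Real.norm_of_nonneg (by positivity)]; simp
  · exact (measurable_norm.pow_const α).aestronglyMeasurable

lemma avg_bound (α : ℝ) (h1 : -2 < α) (h2 : α ≤ 0) : ∃ K : ℝ, 0 ≤ K ∧ ∀ (y : E2) (δ : ℝ), y ≠ 0 →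
    0 < δ → ∫ x in closedBall y δ, ‖x‖ ^ α ≤
      K * (volume : Measure E2).real (closedBall 0 δ) * ‖y‖ ^ α := by
  set c := ∫ x in closedBall (0 : E2) 1, ‖x‖ ^ α with hc
  set v := (volume : Measure E2).real (closedBall 0 1) with hv
  have hc0 : 0 ≤ c := integral_nonneg fun x => by positivity
  have hv0 : 0 < v := by
    rw [hv, Measure.real]
    exact ENNReal.toReal_pos (measure_closedBall_pos _ _ one_pos).ne' measure_closedBall_lt_top.ne
  have hli := locInt_rpow α h1
  have hvol : ∀ δ : ℝ, 0 < δ → (volume : Measure E2).real (closedBall 0 δ) = δ ^ 2 * v := by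
    intro δ hδ
    have := Measure.addHaar_real_closedBall (volume : Measure E2) 0 hδ.le
    rw [this, hv, Measure.addHaar_real_closedBall_eq_addHaar_real_ball]
    simp
  clear_value c v
  refine ⟨2 ^ (-α) * (1 + 3 ^ (2 + α) * c / v), by positivity, ?_⟩
  intro y δ hy hδ
  have hy0 : 0 < ‖y‖ := norm_pos_iff.2 hy
  have hhalf : (‖y‖ / 2) ^ α = 2 ^ (-α) * ‖y‖ ^ α := by
    rw [Real.div_rpow hy0.le (by norm_num), Real.rpow_neg (by norm_num)]
    field_simp
  rw [hvol δ hδ]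
  have hcen : (volume : Measure E2).real (closedBall y δ) =
      (volume : Measure E2).real (closedBall 0 δ) := by
    rw [Measure.real, Measure.real, Measure.addHaar_closedBall_center]
  rcases le_or_gt δ (‖y‖ / 2) with hd | hd
  · have : ∫ x in closedBall y δ, ‖x‖ ^ α ≤ ∫ x in closedBall y δ, (‖y‖ / 2) ^ α := by
      refine setIntegral_mono_on (hli.integrableOn_isCompact (isCompact_closedBall _ _))
        (integrableOn_const measure_closedBall_lt_top.ne) measurableSet_closedBall ?_
      intro x hx
      apply Real.rpow_le_rpow_of_nonpos (by positivity) _ h2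
      have h3 : ‖y - x‖ ≤ δ := by rw [← dist_eq_norm, dist_comm]; exact hx
      have := norm_sub_norm_le y x
      linarith
    refine this.trans ?_
    rw [setIntegral_const, smul_eq_mul, hhalf, hcen, hvol δ hδ]
    have : 0 ≤ 3 ^ (2 + α) * c / v := by positivity
    have h5 : 0 ≤ δ ^ 2 * v * (2 ^ (-α) * ‖y‖ ^ α) := by positivity
    nlinarith [mul_nonneg this h5]
  · have hsub : closedBall y δ ⊆ closedBall (0 : E2) (3 * δ) := by
      intro x hx
      have h3 : ‖x - y‖ ≤ δ := by rw [← dist_eq_norm]; exact hx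
      have := norm_sub_norm_le x y
      rw [mem_closedBall_zero_iff]
      linarith
    have h4 : ∫ x in closedBall y δ, ‖x‖ ^ α ≤ ∫ x in closedBall (0 : E2) (3 * δ), ‖x‖ ^ α := by
      refine setIntegral_mono_set (hli.integrableOn_isCompact (isCompact_closedBall _ _)) ?_ ?_
      · exact Filter.Eventually.of_forall fun x => by simp only [Pi.zero_apply]; positivity
      · exact hsub.eventuallyLE
    have h5 := Measure.setIntegral_comp_smul_of_pos (volume : Measure E2) (fun x => ‖x‖ ^ α)
      (closedBall (0 : E2) 1) (R := 3 * δ) (by positivity)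
    rw [_root_.smul_closedBall _ _ zero_le_one] at h5
    have h6 : ∫ x in closedBall (0 : E2) 1, ‖(3 * δ) • x‖ ^ α = (3 * δ) ^ α * c := by
      rw [hc, ← integral_const_mul]
      congr 1; ext x
      rw [norm_smul, Real.norm_of_nonneg (by positivity), Real.mul_rpow (by positivity) (by positivity)]
    rw [h6] at h5
    simp only [smul_zero, mul_one, finrank_euclideanSpace, Fintype.card_fin, smul_eq_mul,
      Real.norm_of_nonneg (show 0 ≤ 3 * δ by positivity)] at h5
    have h7 : ∫ x in closedBall (0 : E2) (3 * δ), ‖x‖ ^ α = 3 ^ (2 + α) * δ ^ 2 * δ ^ α * c := by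
      have : (3 * δ) ^ 2 * ((3 * δ) ^ α * c) = ∫ x in closedBall (0 : E2) (3 * δ), ‖x‖ ^ α := by
        rw [h5]; field_simp
      rw [← this, Real.rpow_add (by norm_num), Real.mul_rpow (by norm_num) hδ.le]
      norm_num; ring
    have h8 : δ ^ α ≤ 2 ^ (-α) * ‖y‖ ^ α := by
      rw [← hhalf]
      exact Real.rpow_le_rpow_of_nonpos (by positivity) hd.le h2
    rw [h7] at h4
    refine h4.trans ?_
    calc 3 ^ (2 + α) * δ ^ 2 * δ ^ α * c ≤ 3 ^ (2 + α) * δ ^ 2 * (2 ^ (-α) * ‖y‖ ^ α) * c := by gcongr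
      _ ≤ 2 ^ (-α) * (1 + 3 ^ (2 + α) * c / v) * (δ ^ 2 * v) * ‖y‖ ^ α := by
        have : 2 ^ (-α) * (1 + 3 ^ (2 + α) * c / v) * (δ ^ 2 * v) * ‖y‖ ^ α =
          2 ^ (-α) * (δ ^ 2 * v) * ‖y‖ ^ α + 3 ^ (2 + α) * δ ^ 2 * (2 ^ (-α) * ‖y‖ ^ α) * c := by
          field_simp
        rw [this]
        have : 0 ≤ 2 ^ (-α) * (δ ^ 2 * v) * ‖y‖ ^ α := by positivity
        linarith

lemma curve_locInt (g : ℝ → E2) (hg : ContDiff ℝ (⊤ : ℕ∞) g) (hd : ∀ t, deriv g t ≠ 0)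
    (p : ℝ) (hp : -1 < p) : LocallyIntegrable (fun t => ‖g t‖ ^ p) volume := by
  have hgc := hg.continuous
  intro t₀
  by_cases h0 : 0 ≤ p
  · exact (Continuous.locallyIntegrable (hgc.norm.rpow_const fun _ => Or.inr h0)) t₀
  by_cases hz : g t₀ = 0
  · have hder : HasDerivAt g (deriv g t₀) t₀ := (hg.differentiable (by simp) t₀).hasDerivAt
    set c := ‖deriv g t₀‖ / 2 with hc
    have hc0 : 0 < c := by have := norm_pos_iff.2 (hd t₀); positivity
    have hev : ∀ᶠ t in nhds t₀, c * |t - t₀| ≤ ‖g t‖ := by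
      have := hder.isLittleO.def hc0
      filter_upwards [this] with t ht
      rw [hz, sub_zero] at ht
      have h1 := norm_sub_norm_le ((t - t₀) • deriv g t₀) (g t)
      rw [norm_sub_rev, norm_smul] at h1
      rw [Real.norm_eq_abs] at ht h1
      have : ‖deriv g t₀‖ = 2 * c := by rw [hc]; ring
      rw [this] at h1
      nlinarith
    have hli : LocallyIntegrable (fun t : ℝ => c ^ p * |t - t₀| ^ p) volume := by
      have h1 : LocallyIntegrable (fun t : ℝ => |t| ^ p) volume := by
        refine locallyIntegrable_of_norm_le_rpow (C := 1) (α := -p) (by simp) (by simp; linarith) ?_ ?_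
        · refine Filter.Eventually.of_forall fun x => ?_
          rw [Real.norm_of_nonneg (by positivity)]; simp
        · exact (measurable_norm.pow_const p).aestronglyMeasurable
      intro s
      obtain ⟨U, hU, hUi⟩ := h1 (s - t₀)
      have hmp : MeasurePreserving (fun t : ℝ => t - t₀) volume volume :=
        measurePreserving_sub_right volume t₀
      have hemb : MeasurableEmbedding (fun t : ℝ => t - t₀) :=
        (Homeomorph.subRight t₀).measurableEmbedding
      have h2 := (hmp.integrableOn_comp_preimage hemb (f := fun t : ℝ => |t| ^ p) (s := U)).2 hUi
      refine ⟨(fun t => t - t₀) ⁻¹' U, ?_, h2.const_mul _⟩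
      exact (by fun_prop : Continuous fun t : ℝ => t - t₀).continuousAt.preimage_mem_nhds hU
    obtain ⟨U, hU, hUi⟩ := hli t₀
    obtain ⟨V, hV, hVo, htV⟩ := _root_.mem_nhds_iff.1 (Filter.inter_mem hU hev)
    refine ⟨V, hVo.mem_nhds htV, ?_⟩
    have hVU : V ⊆ U := fun x hx => (hV hx).1
    refine (hUi.mono_set hVU).mono' ?_ ?_
    · exact ((hgc.measurable.norm).pow_const p).aestronglyMeasurable
    · have hne : ∀ᵐ t : ℝ, t ≠ t₀ := by simp [ae_iff, measure_singleton]
      filter_upwards [ae_restrict_mem hVo.measurableSet, ae_restrict_of_ae hne] with t ht hne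
      rw [Real.norm_of_nonneg (by positivity), ← Real.mul_rpow hc0.le (abs_nonneg _)]
      apply Real.rpow_le_rpow_of_nonpos _ (hV ht).2 (by linarith)
      have : 0 < |t - t₀| := abs_pos.2 (sub_ne_zero.2 hne)
      positivity
  · have hca : ContinuousAt (fun t => ‖g t‖ ^ p) t₀ :=
      (hgc.continuousAt.norm).rpow_const (Or.inl (norm_ne_zero_iff.2 hz))
    refine hca.integrableAtFilter ?_ (Measure.finiteAt_nhds _ _)
    exact ⟨Set.univ, Filter.univ_mem, ((hgc.measurable.norm).pow_const p).aestronglyMeasurable⟩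

lemma curve_int (g : ℝ → E2) (hg : ContDiff ℝ (⊤ : ℕ∞) g) (hper : Function.Periodic g 1)
    (hd : ∀ t, deriv g t ≠ 0) :
    μH[1] (Set.range g) < ⊤ ∧ ∀ p : ℝ, -1 < p →
      IntegrableOn (fun x => ‖x‖ ^ p) (Set.range g) μH[1] := by
  have hgc := hg.continuous
  have hrange : Set.range g = g '' Set.Icc 0 1 := by
    have := hper.image_Icc one_pos 0
    rw [zero_add] at this
    exact this.symm
  obtain ⟨K, hK⟩ : ∃ K, LipschitzOnWith K g (Set.Icc 0 1) :=
    (hg.of_le (by simp) : ContDiff ℝ 1 g).contDiffOn.exists_lipschitzOnWith (by simp)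
      (convex_Icc 0 1) isCompact_Icc
  have hmeas : (μH[1] : Measure E2).restrict (Set.range g) ≤
      (K : ENNReal) • (Measure.map g (volume.restrict (Set.Icc (0:ℝ) 1))) := by
    rw [Measure.le_iff]
    intro B hB
    rw [Measure.restrict_apply hB, Measure.smul_apply, Measure.map_apply hgc.measurable hB,
      Measure.restrict_apply (hgc.measurable hB), hrange, smul_eq_mul]
    have h1 : B ∩ g '' Set.Icc 0 1 = g '' (g ⁻¹' B ∩ Set.Icc 0 1) := by
      rw [Set.inter_comm (g ⁻¹' B), Set.image_inter_preimage, Set.inter_comm]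
    rw [h1]
    have := (hK.mono (Set.inter_subset_right (s := g ⁻¹' B))).hausdorffMeasure_image_le
      (d := 1) zero_le_one
    rw [ENNReal.rpow_one, hausdorffMeasure_real] at this
    exact this
  constructor
  · have := hmeas Set.univ
    rw [Measure.restrict_apply_univ] at this
    refine this.trans_lt ?_
    rw [Measure.smul_apply, Measure.map_apply hgc.measurable MeasurableSet.univ]
    simp
  · intro p hp
    have h1 : Integrable (fun t => ‖g t‖ ^ p) (volume.restrict (Set.Icc (0:ℝ) 1)) :=
      (curve_locInt g hg hd p hp).integrableOn_isCompact isCompact_Icc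
    have h2 : Integrable (fun x : E2 => ‖x‖ ^ p) (Measure.map g (volume.restrict (Set.Icc (0:ℝ) 1))) := by
      rw [integrable_map_measure (measurable_norm.pow_const p).aestronglyMeasurable
        hgc.measurable.aemeasurable]
      exact h1
    exact (h2.smul_measure (by simp)).mono_measure hmeas

lemma boundary_int (Ω : Set E2) (h : HasSmoothBoundary Ω) :
    μH[1] (frontier Ω) < ⊤ ∧ ∀ p : ℝ, -1 < p →
      IntegrableOn (fun x => ‖x‖ ^ p) (frontier Ω) μH[1] := by
  obtain ⟨n, g, hg, hper, hd, hS⟩ := h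
  rw [hS]
  constructor
  · refine (measure_iUnion_le _).trans_lt ?_
    rw [tsum_fintype]
    exact ENNReal.sum_lt_top.2 fun i _ => (curve_int (g i) (hg i) (hper i) (hd i)).1
  · intro p hp
    rw [integrableOn_finite_iUnion]
    exact fun i => (curve_int (g i) (hg i) (hper i) (hd i)).2 p hp

noncomputable def bump (n : ℕ) : ContDiffBump (0 : E2) where
  rIn := 1 / ((n : ℝ) + 1)
  rOut := 2 / ((n : ℝ) + 1)
  rIn_pos := by positivity
  rIn_lt_rOut := by gcongr; norm_num

noncomputable def rho (n : ℕ) : E2 → ℝ := (bump n).normed volume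

lemma bump_rOut (n : ℕ) : (bump n).rOut = 2 / ((n : ℝ) + 1) := rfl

lemma bump_rOut_le (n : ℕ) : (bump n).rOut ≤ 2 := by
  rw [bump_rOut]
  apply div_le_self (by norm_num)
  have : (0:ℝ) ≤ n := by positivity
  linarith

lemma rho_nonneg (n : ℕ) (x : E2) : 0 ≤ rho n x := (bump n).nonneg_normed x

lemma rho_contDiff (n : ℕ) : ContDiff ℝ (⊤ : ℕ∞) (rho n) := (bump n).contDiff_normed

lemma rho_cont (n : ℕ) : Continuous (rho n) := (rho_contDiff n).continuous

lemma rho_supp (n : ℕ) : HasCompactSupport (rho n) := (bump n).hasCompactSupport_normed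

lemma rho_neg (n : ℕ) (x : E2) : rho n (-x) = rho n x := (bump n).normed_neg x

lemma rho_integral (n : ℕ) : ∫ x, rho n x = 1 := (bump n).integral_normed

lemma rho_integrable (n : ℕ) : Integrable (rho n) :=
  (rho_cont n).integrable_of_hasCompactSupport (rho_supp n)

lemma rho_le (n : ℕ) (x : E2) :
    rho n x ≤ 4 / (volume : Measure E2).real (closedBall 0 (bump n).rOut) := by
  have := (bump n).normed_le_div_measure_closedBall_rOut volume 2 (by
    simp only [bump]; apply le_of_eq; ring) x
  norm_num at this ⊢
  exact this

lemma rho_zero (n : ℕ) (x : E2) (hx : (bump n).rOut < ‖x‖) : rho n x = 0 := by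
  by_contra h
  have : x ∈ Function.support ((bump n).normed volume) := h
  rw [(bump n).support_normed_eq, mem_ball_zero_iff] at this
  linarith

lemma bump_tendsto : Filter.Tendsto (fun n => (bump n).rOut) Filter.atTop (nhds 0) := by
  have := (tendsto_one_div_add_atTop_nhds_zero_nat (𝕜 := ℝ)).const_mul 2
  simp only [bump_rOut]
  refine (this.congr fun n => ?_).trans (by simp)
  ring

/-- smoothed weight. -/
noncomputable def G (α : ℝ) (n : ℕ) (y : E2) : ℝ := ∫ x, rho n (x - y) * ‖x‖ ^ α

lemma G_nonneg (α : ℝ) (n : ℕ) (y : E2) : 0 ≤ G α n y :=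
  integral_nonneg fun x => mul_nonneg (rho_nonneg _ _) (by positivity)

lemma G_integrable (α : ℝ) (h : -2 < α) (n : ℕ) (y : E2) :
    Integrable (fun x => rho n (x - y) * ‖x‖ ^ α) := by
  have hc := rho_cont n
  have := (locInt_rpow α h).integrable_smul_left_of_hasCompactSupport
    (g := fun x => rho n (x - y)) (by fun_prop)
    ((rho_supp n).comp_homeomorph (Homeomorph.subRight y))
  simpa using this

lemma G_meas (α : ℝ) (n : ℕ) : StronglyMeasurable (G α n) := by
  have hc := (rho_cont n).measurable
  refine StronglyMeasurable.integral_prod_right (f := fun y x : E2 => rho n (x - y) * ‖x‖ ^ α) ?_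
  apply Measurable.stronglyMeasurable
  unfold Function.uncurry
  exact (hc.comp (measurable_snd.sub measurable_fst)).mul (measurable_snd.norm.pow_const α)

lemma conv_swap (n : ℕ) (g : E2 → ℝ) (y : E2) :
    ∫ x, rho n (x - y) * g x =
      convolution ((bump n).normed volume) g (ContinuousLinearMap.lsmul ℝ ℝ) volume y := by
  rw [convolution_def, ← integral_sub_left_eq_self (fun x => rho n (x - y) * g x) volume y]
  congr 1; ext t
  have : y - t - y = -t := by abel
  rw [this, rho_neg]
  simp [rho]

lemma G_tendsto (α : ℝ) (y : E2) (hy : y ≠ 0) :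
    Filter.Tendsto (fun n => G α n y) Filter.atTop (nhds (‖y‖ ^ α)) := by
  simp only [G, conv_swap]
  refine ContDiffBump.convolution_tendsto_right bump_tendsto
    (g := fun _ => fun x : E2 => ‖x‖ ^ α) (k := fun _ => y)
    (Filter.Eventually.of_forall fun _ => (measurable_norm.pow_const α).aestronglyMeasurable) ?_
    tendsto_const_nhds
  have hca : ContinuousAt (fun x : E2 => ‖x‖ ^ α) y :=
    continuousAt_id.norm.rpow_const (Or.inl (norm_ne_zero_iff.2 hy))
  exact hca.tendsto.comp Filter.tendsto_snd

lemma G_bound_neg (α : ℝ) (h1 : -2 < α) (h2 : α ≤ 0) : ∃ K : ℝ, ∀ n y, y ≠ 0 →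
    G α n y ≤ K * ‖y‖ ^ α := by
  obtain ⟨K, hK0, hK⟩ := avg_bound α h1 h2
  refine ⟨4 * K, fun n y hy => ?_⟩
  set V := (volume : Measure E2).real (closedBall 0 (bump n).rOut) with hV
  have hV0 : 0 < V :=
    ENNReal.toReal_pos (measure_closedBall_pos _ _ (bump n).rOut_pos).ne' measure_closedBall_lt_top.ne
  have e1 : G α n y = ∫ x in closedBall y (bump n).rOut, rho n (x - y) * ‖x‖ ^ α := by
    rw [G, setIntegral_eq_integral_of_forall_compl_eq_zero]
    intro x hx
    rw [rho_zero, zero_mul]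
    rw [mem_closedBall, not_le, dist_eq_norm] at hx
    exact hx
  have hli := (locInt_rpow α h1).integrableOn_isCompact (isCompact_closedBall y (bump n).rOut)
  have hle := hK y (bump n).rOut hy (bump n).rOut_pos
  rw [← hV] at hle
  have hrho := rho_le n
  rw [← hV] at hrho
  clear_value V
  rw [e1]
  calc ∫ x in closedBall y (bump n).rOut, rho n (x - y) * ‖x‖ ^ α
      ≤ ∫ x in closedBall y (bump n).rOut, 4 / V * ‖x‖ ^ α := by
        refine integral_mono (G_integrable α h1 n y).integrableOn (hli.const_mul _) fun x => ?_
        exact mul_le_mul_of_nonneg_right (hrho _) (by positivity)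
    _ = 4 / V * ∫ x in closedBall y (bump n).rOut, ‖x‖ ^ α := integral_const_mul _ _
    _ ≤ 4 / V * (K * V * ‖y‖ ^ α) := by gcongr
    _ = 4 * K * ‖y‖ ^ α := by field_simp

lemma G_bound_pos (α : ℝ) (h1 : 0 ≤ α) (R : ℝ) (n : ℕ) (y : E2) (hy : ‖y‖ ≤ R) :
    G α n y ≤ (R + 2) ^ α := by
  have hi : Integrable (fun x => rho n (x - y)) := (rho_integrable n).comp_sub_right y
  calc G α n y ≤ ∫ x, rho n (x - y) * (R + 2) ^ α := by
        refine integral_mono (G_integrable α (by linarith) n y) (hi.mul_const _) fun x => ?_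
        by_cases hx : (bump n).rOut < ‖x - y‖
        · simp [rho_zero n _ hx]
        · refine mul_le_mul_of_nonneg_left ?_ (rho_nonneg _ _)
          apply Real.rpow_le_rpow (norm_nonneg _) _ h1
          have := bump_rOut_le n
          have := norm_sub_norm_le x y
          linarith
    _ = (R + 2) ^ α := by
        rw [integral_mul_const, integral_sub_right_eq_self (rho n) y, rho_integral, one_mul]

lemma G_dominated (Ω : Set E2) (hb : Bornology.IsBounded Ω) (h : HasSmoothBoundary Ω)
    (α : ℝ) (h1 : -1 < α) : ∃ b : E2 → ℝ, IntegrableOn b (frontier Ω) μH[1] ∧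
      ∀ n, ∀ᵐ y ∂((μH[1] : Measure E2).restrict (frontier Ω)), ‖G α n y‖ ≤ b y := by
  obtain ⟨hfin, hint⟩ := boundary_int Ω h
  have := Measure.nullSingletonClass_hausdorff E2 one_pos
  have hne : ∀ᵐ y ∂(μH[1] : Measure E2), y ≠ 0 := by simp [ae_iff, measure_singleton]
  rcases le_or_gt 0 α with h0 | h0
  · obtain ⟨R, hR⟩ := (hb.closure).exists_norm_le
    refine ⟨fun _ => (R + 2) ^ α, integrableOn_const hfin.ne, fun n => ?_⟩
    filter_upwards [ae_restrict_mem isClosed_frontier.measurableSet] with y hy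
    rw [Real.norm_of_nonneg (G_nonneg _ _ _)]
    exact G_bound_pos α h0 R n y (hR y hy.1)
  · obtain ⟨K, hK⟩ := G_bound_neg α (by linarith) h0.le
    refine ⟨fun y => K * ‖y‖ ^ α, (hint α h1).const_mul K, fun n => ?_⟩
    filter_upwards [ae_restrict_of_ae hne] with y hy
    rw [Real.norm_of_nonneg (G_nonneg _ _ _)]
    exact hK n y hy

lemma G_lim (Ω : Set E2) (hb : Bornology.IsBounded Ω) (h : HasSmoothBoundary Ω)
    (α : ℝ) (h1 : -1 < α) :
    Filter.Tendsto (fun n => ∫ y in frontier Ω, G α n y ∂μH[1]) Filter.atTop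
      (nhds (∫ y in frontier Ω, ‖y‖ ^ α ∂μH[1])) := by
  obtain ⟨b, hbi, hbb⟩ := G_dominated Ω hb h α h1
  have := Measure.nullSingletonClass_hausdorff E2 one_pos
  have hne : ∀ᵐ y ∂(μH[1] : Measure E2), y ≠ 0 := by simp [ae_iff, measure_singleton]
  refine tendsto_integral_of_dominated_convergence b
    (fun n => (G_meas α n).aestronglyMeasurable) hbi hbb ?_
  filter_upwards [ae_restrict_of_ae hne] with y hy using G_tendsto α y hy

lemma grad_int_le (Ω : Set E2) (hΩ : IsOpen Ω) (hb : Bornology.IsBounded Ω)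
    (h : HasSmoothBoundary Ω) (α : ℝ) (h1 : -1 < α) (n : ℕ) :
    ∫ x, ‖fderiv ℝ (moll Ω (rho n)) x‖ * ‖x‖ ^ α ≤ ∫ y in frontier Ω, G α n y ∂μH[1] := by
  obtain ⟨hfin, hint⟩ := boundary_int Ω h
  have hfinm : IsFiniteMeasure ((μH[1] : Measure E2).restrict (frontier Ω)) :=
    ⟨by simpa using hfin⟩
  obtain ⟨b, hbi, hbb⟩ := G_dominated Ω hb h α h1
  have hGi : Integrable (G α n) ((μH[1] : Measure E2).restrict (frontier Ω)) :=
    Integrable.mono' hbi (G_meas α n).aestronglyMeasurable (hbb n)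
  have hc := rho_cont n
  have hu := moll_contDiff Ω hΩ (rho n) (rho_contDiff n) (rho_supp n)
  have hmeas : AEStronglyMeasurable (fun x : E2 => ‖fderiv ℝ (moll Ω (rho n)) x‖ * ‖x‖ ^ α) :=
    ((hu.continuous_fderiv (by simp)).norm.measurable.mul
      (measurable_norm.pow_const α)).aestronglyMeasurable
  rw [integral_eq_lintegral_of_nonneg_ae (Filter.Eventually.of_forall fun x => by
      simp only [Pi.zero_apply]; positivity) hmeas,
    integral_eq_lintegral_of_nonneg_ae (Filter.Eventually.of_forall fun y => G_nonneg _ _ _)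
      (G_meas α n).aestronglyMeasurable]
  have hfinG : ∫⁻ y in frontier Ω, ENNReal.ofReal (G α n y) ∂μH[1] ≠ ⊤ := by
    rw [← ofReal_integral_eq_lintegral_ofReal hGi
      (Filter.Eventually.of_forall fun y => G_nonneg _ _ _)]
    exact ENNReal.ofReal_ne_top
  refine ENNReal.toReal_mono hfinG ?_
  calc ∫⁻ x, ENNReal.ofReal (‖fderiv ℝ (moll Ω (rho n)) x‖ * ‖x‖ ^ α)
      ≤ ∫⁻ x, ∫⁻ y in frontier Ω, ENNReal.ofReal (rho n (x - y) * ‖x‖ ^ α) ∂μH[1] := by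
        refine lintegral_mono fun x => ?_
        have hi : Integrable (fun y => rho n (x - y))
            ((μH[1] : Measure E2).restrict (frontier Ω)) := by
          obtain ⟨B, hB⟩ := (rho_supp n).exists_bound_of_continuous hc
          exact Integrable.of_bound
            (by fun_prop : Continuous fun y => rho n (x - y)).aestronglyMeasurable B
            (Filter.Eventually.of_forall fun y => hB _)
        rw [← ofReal_integral_eq_lintegral_ofReal (hi.mul_const _)
          (Filter.Eventually.of_forall fun y => mul_nonneg (rho_nonneg _ _) (by positivity)),
          integral_mul_const]
        apply ENNReal.ofReal_le_ofReal
        gcongr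
        exact moll_grad_le Ω hΩ (rho n) (rho_nonneg n) (rho_contDiff n) (rho_supp n) hfin x
    _ = ∫⁻ y in frontier Ω, (∫⁻ x, ENNReal.ofReal (rho n (x - y) * ‖x‖ ^ α)) ∂μH[1] := by
        rw [lintegral_lintegral_swap]
        apply Measurable.aemeasurable
        unfold Function.uncurry
        exact ((hc.measurable.comp (measurable_fst.sub measurable_snd)).mul
          (measurable_fst.norm.pow_const α)).ennreal_ofReal
    _ = ∫⁻ y in frontier Ω, ENNReal.ofReal (G α n y) ∂μH[1] := by
        refine lintegral_congr fun y => ?_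
        rw [G, ofReal_integral_eq_lintegral_ofReal (G_integrable α (by linarith) n y)
          (Filter.Eventually.of_forall fun x => mul_nonneg (rho_nonneg _ _) (by positivity))]

lemma moll_conv (Ω : Set E2) (n : ℕ) (x : E2) :
    moll Ω (rho n) x = ∫ y, rho n (y - x) * Ω.indicator (fun _ => (1:ℝ)) y := by
  rw [moll_apply]
  congr 1; ext y
  rw [mul_comm, ← rho_neg, neg_sub]

lemma moll_nonneg (Ω : Set E2) (n : ℕ) (x : E2) : 0 ≤ moll Ω (rho n) x := by
  rw [moll_apply]
  exact integral_nonneg fun y => mul_nonneg (Set.indicator_nonneg (by simp) _) (rho_nonneg _ _)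

lemma moll_le_one (Ω : Set E2) (hΩ : IsOpen Ω) (n : ℕ) (x : E2) : moll Ω (rho n) x ≤ 1 := by
  have hi := moll_int Ω hΩ (rho n) (rho_cont n) (rho_supp n) x
  rw [moll_apply]
  calc _ ≤ ∫ y, rho n (x - y) := by
        refine integral_mono hi ((rho_integrable n).comp_sub_left x) fun y => ?_
        refine mul_le_of_le_one_left (rho_nonneg _ _) ?_
        by_cases b : y ∈ Ω <;> simp [b]
    _ = 1 := by rw [integral_sub_left_eq_self (rho n) volume x, rho_integral]

lemma moll_tendsto (Ω : Set E2) (hΩ : IsOpen Ω) (x : E2) (hx : x ∈ Ω) :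
    Filter.Tendsto (fun n => moll Ω (rho n) x) Filter.atTop (nhds 1) := by
  simp only [moll_conv, conv_swap]
  refine ContDiffBump.convolution_tendsto_right bump_tendsto
    (g := fun _ => Ω.indicator (fun _ => (1:ℝ))) (k := fun _ => x)
    (Filter.Eventually.of_forall fun _ =>
      (measurable_const.indicator hΩ.measurableSet).aestronglyMeasurable) ?_
    tendsto_const_nhds
  have h1 : Filter.Tendsto (Ω.indicator (fun _ => (1:ℝ))) (nhds x) (nhds 1) := by
    refine tendsto_const_nhds.congr' ?_
    filter_upwards [hΩ.mem_nhds hx] with y hy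
    simp [hy]
  exact h1.comp Filter.tendsto_snd

lemma moll_supp (Ω : Set E2) (hb : Bornology.IsBounded Ω) (n : ℕ) :
    HasCompactSupport (moll Ω (rho n)) := by
  refine HasCompactSupport.convolution _ ?_ (rho_supp n)
  refine HasCompactSupport.intro hb.isCompact_closure fun x hx => ?_
  exact Set.indicator_of_notMem (fun h => hx (subset_closure h)) _

lemma lhs_lim (Ω : Set E2) (hΩ : IsOpen Ω) (hb : Bornology.IsBounded Ω) (r q : ℝ) (hr : 0 < r)
    (hq : -2 < q) :
    Filter.Tendsto (fun n => ∫ x in Ω, |moll Ω (rho n) x| ^ r * ‖x‖ ^ q) Filter.atTop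
      (nhds (∫ x in Ω, ‖x‖ ^ q)) := by
  have hi : IntegrableOn (fun x : E2 => ‖x‖ ^ q) Ω :=
    ((locInt_rpow q hq).integrableOn_isCompact hb.isCompact_closure).mono_set subset_closure
  refine tendsto_integral_of_dominated_convergence (fun x => ‖x‖ ^ q) (fun n => ?_) hi
    (fun n => ?_) ?_
  · have hu := (moll_contDiff Ω hΩ (rho n) (rho_contDiff n) (rho_supp n)).continuous.measurable
    exact ((hu.abs.pow_const r).mul (measurable_norm.pow_const q)).aestronglyMeasurable
  · refine Filter.Eventually.of_forall fun x => ?_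
    rw [Real.norm_of_nonneg (by positivity)]
    refine mul_le_of_le_one_left (by positivity) (Real.rpow_le_one (abs_nonneg _) ?_ hr.le)
    rw [abs_of_nonneg (moll_nonneg _ _ _)]
    exact moll_le_one Ω hΩ n x
  · filter_upwards [ae_restrict_mem hΩ.measurableSet] with x hx
    have h1 := ((moll_tendsto Ω hΩ x hx).abs.rpow_const (p := r) (Or.inr hr.le)).mul_const (‖x‖ ^ q)
    simpa using h1

lemma lhs_le (Ω : Set E2) (hΩ : IsOpen Ω) (hb : Bornology.IsBounded Ω) (r q : ℝ) (hr : 0 < r)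
    (hq : -2 < q) (n : ℕ) :
    ∫ x in Ω, |moll Ω (rho n) x| ^ r * ‖x‖ ^ q ≤ ∫ x, |moll Ω (rho n) x| ^ r * ‖x‖ ^ q := by
  have hu := (moll_contDiff Ω hΩ (rho n) (rho_contDiff n) (rho_supp n)).continuous
  refine setIntegral_le_integral ?_ (Filter.Eventually.of_forall fun x => by
    simp only [Pi.zero_apply]; positivity)
  have := (locInt_rpow q hq).integrable_smul_left_of_hasCompactSupport
    (g := fun x => |moll Ω (rho n) x| ^ r) (hu.abs.rpow_const fun _ => Or.inr hr.le)
    ((moll_supp Ω hb n).comp_left (g := fun t : ℝ => |t| ^ r) (by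
      simp [Real.zero_rpow hr.ne']))
  simpa using this

/-- The Caffarelli–Kohn–Nirenberg inequality
`‖u|x|^γ‖_{L^r} ≤ C ‖Du |x|^α‖_{L^1}` for all `u ∈ C_c^∞(ℝ²)` (with exponents
satisfying `r > 0`, `0 ≤ α − γ ≤ 1`, `0 < 1/r + γ/2 = (α+1)/2`) implies the
weighted isoperimetric inequality `(∫_Ω |x|^q)^((p+1)/(q+2)) ≤ C ∫_{∂Ω} |x|^p dσ`
with `p = α`, `q = γr`, for every bounded open smooth set `Ω ⊂ ℝ²`; moreover
these exponents satisfy `−2 < p − 1 ≤ q ≤ 2p`. -/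
theorem ckn_implies_weighted_isoperimetric
    (α γ r : ℝ) (hr : 0 < r)
    (h1 : 0 ≤ α - γ) (h2 : α - γ ≤ 1)
    (h3 : 0 < 1 / r + γ / 2) (h4 : 1 / r + γ / 2 = (α + 1) / 2)
    (p q : ℝ) (hp : p = α) (hq : q = γ * r)
    (C : ℝ) (hC : 0 < C)
    (hckn : ∀ u : EuclideanSpace ℝ (Fin 2) → ℝ, ContDiff ℝ (⊤ : ℕ∞) u →
      HasCompactSupport u →
      (∫ x, |u x| ^ r * ‖x‖ ^ (γ * r)) ^ (1 / r) ≤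
        C * ∫ x, ‖fderiv ℝ u x‖ * ‖x‖ ^ α) :
    (∀ Ω : Set (EuclideanSpace ℝ (Fin 2)),
      IsOpen Ω → Bornology.IsBounded Ω → HasSmoothBoundary Ω →
      (∫ x in Ω, ‖x‖ ^ q) ^ ((p + 1) / (q + 2)) ≤
        C * ∫ x in frontier Ω, ‖x‖ ^ p ∂μH[1]) ∧
    (-2 < p - 1 ∧ p - 1 ≤ q ∧ q ≤ 2 * p) := by
  subst hp hq
  have hp1 : -1 < p := by linarith
  have hrr : r * (1 / r) = 1 := by field_simp
  have hid : γ * r + 2 = r * (p + 1) := by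
    have h5 : p + 1 = 2 * (1 / r) + γ := by linarith
    rw [h5, mul_add, mul_left_comm, hrr]; ring
  have hr1 : 1 ≤ r := by
    have : 1 / r ≤ 1 := by linarith
    nlinarith
  have hr2 : r ≤ 2 := by
    have : 1 / 2 ≤ 1 / r := by linarith
    nlinarith
  have hq2 : -2 < γ * r := by
    have : 0 < r * (p + 1) := mul_pos hr (by linarith)
    linarith
  refine ⟨?_, by linarith, by nlinarith, by nlinarith⟩
  intro Ω hΩ hb hsm
  have hexp : (p + 1) / (γ * r + 2) = 1 / r := by
    rw [hid]
    have : p + 1 ≠ 0 := by linarith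
    field_simp
  rw [hexp]
  have hL := (lhs_lim Ω hΩ hb r (γ * r) hr hq2).rpow_const (p := 1 / r) (Or.inr (by positivity))
  have hR := (G_lim Ω hb hsm p hp1).const_mul C
  refine le_of_tendsto_of_tendsto' hL hR fun n => ?_
  refine (Real.rpow_le_rpow (integral_nonneg fun x => by positivity)
    (lhs_le Ω hΩ hb r (γ * r) hr hq2 n) (by positivity)).trans ?_
  refine (hckn _ (moll_contDiff Ω hΩ (rho n) (rho_contDiff n) (rho_supp n))
    (moll_supp Ω hb n)).trans ?_
  exact mul_le_mul_of_nonneg_left (grad_int_le Ω hΩ hb hsm p hp1 n) hC.le
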